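/- There exists an absolute constant C > 0 such that for every prime p and all a₁, a₂, b₁, b₂, h ∈ 𝔽_p with a₁ a₂ ≠ 0, the number of quadruples (y₁, y₂, y₃, y₄) ∈ (𝔽_p \ {0})⁴ satisfying the system a₁ y₁² = a₂ y₂², a₁ y₃² = a₂ y₄², a₁(y₃² − y₁²) + (b₂ − b₁) y₁² y₃² = 0, and h + a₁ y₁ + a₂ y₂ + a₁ y₃ + a₂ y₄ = 0, is at most C · ( gcd(h, a₁² − a₂², p) + gcd(h, b₁ − b₂, p) ), where the gcd's are computed for integer representatives, with the convention gcd(0, 0, p) = p. -/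

import Mathlib

open scoped BigOperators Classical

/-- The pairs of nonzero elements on the quartic `a (z² - y²) + c y² z² = 0` and on the line
`h + α y + β z = 0`. -/
def quarticLinePairs {K : Type*} [Field K] (a c h α β : K) : Set (K × K) :=
  {q | q.1 ≠ 0 ∧ q.2 ≠ 0 ∧ a * (q.2 ^ 2 - q.1 ^ 2) + c * q.1 ^ 2 * q.2 ^ 2 = 0 ∧
    h + α * q.1 + β * q.2 = 0}

section

variable {K : Type*} [Field K]

open Polynomial in
lemma exists_finset_roots_card_le_four {a c h α β : K} (ha : a ≠ 0) (hne : h ≠ 0 ∨ (α ≠ 0 ∧ c ≠ 0)) :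
    ∃ s : Finset K, s.card ≤ 4 ∧ ∀ y : K,
      a * ((h + α * y) ^ 2 - β ^ 2 * y ^ 2) + c * y ^ 2 * (h + α * y) ^ 2 = 0 → y ∈ s := by
  set P : K[X] := C (c * α ^ 2) * X ^ 4 + C (2 * c * h * α) * X ^ 3 +
    C (a * (α ^ 2 - β ^ 2) + c * h ^ 2) * X ^ 2 + C (2 * a * h * α) * X + C (a * h ^ 2) with hP
  have hdeg : P.natDegree ≤ 4 := by rw [hP]; compute_degree
  have hP0 : P ≠ 0 := by
    intro h0
    rcases hne with hh | ⟨hα, hc⟩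
    · have h1 : P.coeff 0 = a * h ^ 2 := by simp [hP, coeff_zero_eq_eval_zero]
      rw [h0, coeff_zero] at h1
      exact mul_ne_zero ha (pow_ne_zero 2 hh) h1.symm
    · have h1 : P.coeff 4 = c * α ^ 2 := by rw [hP]; compute_degree!
      rw [h0, coeff_zero] at h1
      exact mul_ne_zero hc (pow_ne_zero 2 hα) h1.symm
  refine ⟨P.roots.toFinset, (Multiset.toFinset_card_le _).trans ((card_roots' P).trans hdeg),
    fun y hy => ?_⟩
  rw [Multiset.mem_toFinset, mem_roots hP0, IsRoot.def]
  simp only [hP, eval_add, eval_mul, eval_C, eval_pow, eval_X]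
  linear_combination hy

lemma ncard_quarticLinePairs_le_of_right_ne_zero {a c h α β : K} (ha : a ≠ 0) (hβ : β ≠ 0)
    (hne : h ≠ 0 ∨ (α ≠ 0 ∧ c ≠ 0)) : (quarticLinePairs a c h α β).ncard ≤ 4 := by
  obtain ⟨s, hs, hmem⟩ := exists_finset_roots_card_le_four (β := β) ha hne
  refine le_trans ?_ hs
  rw [← Set.ncard_coe_finset s]
  refine Set.ncard_le_ncard_of_injOn Prod.fst ?_ ?_ s.finite_toSet
  · rintro ⟨y, z⟩ ⟨-, -, h3, h4⟩
    refine hmem y ?_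
    simp only at h3 h4 ⊢
    have h5 : h + α * y = -(β * z) := by linear_combination h4
    rw [h5]
    linear_combination β ^ 2 * h3
  · rintro ⟨y, z⟩ ⟨-, -, -, h4⟩ ⟨y', z'⟩ ⟨-, -, -, h4'⟩ (rfl : y = y')
    simp only at h4 h4'
    have : β * z = β * z' := by linear_combination h4 - h4'
    rw [mul_left_cancel₀ hβ this]

lemma ncard_quarticLinePairs_swap (a c h α β : K) :
    (quarticLinePairs a c h α β).ncard = (quarticLinePairs a (-c) h β α).ncard := by
  rw [← Set.ncard_image_of_injective _ Prod.swap_injective]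
  congr 1
  ext ⟨y, z⟩
  simp only [Set.image_swap_eq_preimage_swap, Set.mem_preimage, Prod.swap_prod_mk,
    quarticLinePairs, Set.mem_ofPred_eq]
  constructor
  · rintro ⟨h1, h2, h3, h4⟩
    exact ⟨h2, h1, by linear_combination -h3, by linear_combination h4⟩
  · rintro ⟨h1, h2, h3, h4⟩
    exact ⟨h2, h1, by linear_combination -h3, by linear_combination h4⟩

lemma ncard_quarticLinePairs_le_four {a c h α β : K} (ha : a ≠ 0)
    (hne : h ≠ 0 ∨ (α ≠ 0 ∧ β ≠ 0 ∧ c ≠ 0)) : (quarticLinePairs a c h α β).ncard ≤ 4 := by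
  by_cases hβ : β = 0
  · have hh : h ≠ 0 := hne.resolve_right fun H => H.2.1 hβ
    by_cases hα : α = 0
    · have : quarticLinePairs a c h α β = ∅ := by
        ext q
        simp [quarticLinePairs, hα, hβ, hh]
      simp [this]
    · rw [ncard_quarticLinePairs_swap]
      exact ncard_quarticLinePairs_le_of_right_ne_zero ha hα (Or.inl hh)
  · exact ncard_quarticLinePairs_le_of_right_ne_zero ha hβ (hne.imp_right fun H => ⟨H.1, H.2.2⟩)

lemma ncard_quarticLinePairs_le_two_mul_card [Fintype K] {a : K} (c h α β : K) (ha : a ≠ 0) :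
    (quarticLinePairs a c h α β).ncard ≤ 2 * Fintype.card K := by
  rw [Set.ncard_eq_toFinset_card']
  refine Finset.card_le_mul_card_image_of_maps_to (f := Prod.fst)
    (fun _ _ => Finset.mem_univ _) 2 fun y _ => ?_
  rcases Finset.eq_empty_or_nonempty
    ((quarticLinePairs a c h α β).toFinset.filter fun q => q.1 = y) with he | ⟨⟨y', z⟩, hz⟩
  · rw [he]; simp
  · refine (Finset.card_le_card ?_).trans (Finset.card_le_two (a := (y, z)) (b := (y, -z)))
    rintro ⟨y₁, w⟩ hw
    rw [Finset.mem_filter, Set.mem_toFinset] at hz hw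
    obtain ⟨⟨hy, -, h3, -⟩, rfl : y' = y⟩ := hz
    obtain ⟨⟨-, -, h3', -⟩, rfl : y₁ = y'⟩ := hw
    simp only at hy h3 h3'
    have hlead : a + c * y₁ ^ 2 ≠ 0 := by
      intro h0
      exact mul_ne_zero ha (pow_ne_zero 2 hy) (by linear_combination z ^ 2 * h0 - h3)
    have hsq : w ^ 2 = z ^ 2 := mul_left_cancel₀ hlead (by linear_combination h3' - h3)
    rcases sq_eq_sq_iff_eq_or_eq_neg.mp hsq with rfl | rfl <;> simp

/-- Parametrising `a₁ y² = a₂ y'²` by the square roots `± t` of `a₁ / a₂` reduces the system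
to four instances of `quarticLinePairs`. -/
lemma ncard_kloosterman_system_le [Finite K] {a₁ a₂ c h : K} (ha₂ : a₂ ≠ 0) {N : ℕ}
    (hN : ∀ t s : K, a₂ * t ^ 2 = a₁ → a₂ * s ^ 2 = a₁ →
      (quarticLinePairs a₁ c h (a₁ + a₂ * t) (a₁ + a₂ * s)).ncard ≤ N) :
    Set.ncard {y : K × K × K × K |
      y.1 ≠ 0 ∧ y.2.1 ≠ 0 ∧ y.2.2.1 ≠ 0 ∧ y.2.2.2 ≠ 0 ∧
      a₁ * y.1 ^ 2 = a₂ * y.2.1 ^ 2 ∧ a₁ * y.2.2.1 ^ 2 = a₂ * y.2.2.2 ^ 2 ∧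
      a₁ * (y.2.2.1 ^ 2 - y.1 ^ 2) + c * y.1 ^ 2 * y.2.2.1 ^ 2 = 0 ∧
      h + a₁ * y.1 + a₂ * y.2.1 + a₁ * y.2.2.1 + a₂ * y.2.2.2 = 0} ≤ 4 * N := by
  set S : Set (K × K × K × K) := _
  change Set.ncard S ≤ _
  have hroot : ∀ y z : K, y ≠ 0 → a₁ * y ^ 2 = a₂ * z ^ 2 → a₂ * (z / y) ^ 2 = a₁ := by
    intro y z hy hyz
    field_simp
    linear_combination -hyz
  rcases S.eq_empty_or_nonempty with he | ⟨y, hy⟩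
  · simp [he]
  obtain ⟨t, ht⟩ : ∃ t : K, a₂ * t ^ 2 = a₁ := ⟨_, hroot _ _ hy.1 hy.2.2.2.2.1⟩
  have hpm : ∀ s : K, a₂ * s ^ 2 = a₁ → s = t ∨ s = -t := fun s hs =>
    sq_eq_sq_iff_eq_or_eq_neg.mp (mul_left_cancel₀ ha₂ (hs.trans ht.symm))
  have ht' : a₂ * (-t) ^ 2 = a₁ := by rw [neg_sq, ht]
  let T : K → K → Set (K × K × K × K) := fun u v =>
    (fun q : K × K => (q.1, u * q.1, q.2, v * q.2)) ''
      quarticLinePairs a₁ c h (a₁ + a₂ * u) (a₁ + a₂ * v)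
  have hT : ∀ u v, a₂ * u ^ 2 = a₁ → a₂ * v ^ 2 = a₁ → (T u v).ncard ≤ N := fun u v hu hv =>
    (Set.ncard_image_le (Set.toFinite _)).trans (hN u v hu hv)
  have hsub : S ⊆ (T t t ∪ T t (-t)) ∪ (T (-t) t ∪ T (-t) (-t)) := by
    rintro ⟨y₁, y₂, y₃, y₄⟩ ⟨h1, -, h3, -, h5, h6, h7, h8⟩
    simp only at h1 h3 h5 h6 h7 h8
    have key : (y₁, y₂, y₃, y₄) ∈ T (y₂ / y₁) (y₄ / y₃) := by
      refine ⟨(y₁, y₃), ⟨h1, h3, h7, ?_⟩, ?_⟩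
      · simp only
        field_simp
        linear_combination h8
      · simp only
        rw [div_mul_cancel₀ _ h1, div_mul_cancel₀ _ h3]
    rcases hpm _ (hroot _ _ h1 h5) with hu | hu <;>
      rcases hpm _ (hroot _ _ h3 h6) with hv | hv <;> rw [hu, hv] at key <;>
      simp only [Set.mem_union, key, true_or, or_true]
  have h1 := Set.ncard_le_ncard hsub (Set.toFinite _)
  have h2 := Set.ncard_union_le (T t t ∪ T t (-t)) (T (-t) t ∪ T (-t) (-t))
  have h3 := Set.ncard_union_le (T t t) (T t (-t))
  have h4 := Set.ncard_union_le (T (-t) t) (T (-t) (-t))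
  have h5 := hT t t ht ht
  have h6 := hT t (-t) ht ht'
  have h7 := hT (-t) t ht' ht
  have h8 := hT (-t) (-t) ht' ht'
  omega

lemma add_mul_ne_zero_of_sq_ne_sq {a₁ a₂ t : K} (ha₁ : a₁ ≠ 0) (ht : a₂ * t ^ 2 = a₁)
    (hsq : a₁ ^ 2 ≠ a₂ ^ 2) : a₁ + a₂ * t ≠ 0 := by
  intro h0
  have : a₁ = a₂ := mul_left_cancel₀ ha₁ (by linear_combination (a₁ - a₂ * t) * h0 + a₂ * ht)
  exact hsq (by rw [this])

end

theorem count_solutions_Kloosterman_system :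
    ∃ C : ℝ, 0 < C ∧
      ∀ (p : ℕ), p.Prime → ∀ a₁ a₂ b₁ b₂ h : ZMod p, a₁ * a₂ ≠ 0 →
        ((Set.ncard {y : ZMod p × ZMod p × ZMod p × ZMod p |
            y.1 ≠ 0 ∧ y.2.1 ≠ 0 ∧ y.2.2.1 ≠ 0 ∧ y.2.2.2 ≠ 0 ∧
            a₁ * y.1 ^ 2 = a₂ * y.2.1 ^ 2 ∧
            a₁ * y.2.2.1 ^ 2 = a₂ * y.2.2.2 ^ 2 ∧
            a₁ * (y.2.2.1 ^ 2 - y.1 ^ 2) + (b₂ - b₁) * y.1 ^ 2 * y.2.2.1 ^ 2 = 0 ∧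
            h + a₁ * y.1 + a₂ * y.2.1 + a₁ * y.2.2.1 + a₂ * y.2.2.2 = 0}) : ℝ)
          ≤ C * ((Nat.gcd h.val (Nat.gcd (a₁ ^ 2 - a₂ ^ 2).val p) : ℝ) +
              (Nat.gcd h.val (Nat.gcd (b₁ - b₂).val p) : ℝ)) := by
  refine ⟨8, by norm_num, fun p hp a₁ a₂ b₁ b₂ h ha => ?_⟩
  have : Fact p.Prime := ⟨hp⟩
  have ha₁ : a₁ ≠ 0 := left_ne_zero_of_mul ha
  have ha₂ : a₂ ≠ 0 := right_ne_zero_of_mul ha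
  have hpos : ∀ m n : ℕ, 0 < Nat.gcd m (Nat.gcd n p) := fun m n =>
    Nat.gcd_pos_of_pos_right _ (Nat.gcd_pos_of_pos_right _ hp.pos)
  have hpos₁ := hpos h.val (a₁ ^ 2 - a₂ ^ 2).val
  have hpos₂ := hpos h.val (b₁ - b₂).val
  by_cases hdeg : h = 0 ∧ (a₁ ^ 2 = a₂ ^ 2 ∨ b₁ = b₂)
  · have hS := ncard_kloosterman_system_le (a₁ := a₁) (c := b₂ - b₁) (h := h) ha₂
      fun t s _ _ => ncard_quarticLinePairs_le_two_mul_card _ _ _ _ ha₁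
    rw [ZMod.card] at hS
    have hgcd : p ≤ Nat.gcd h.val (Nat.gcd (a₁ ^ 2 - a₂ ^ 2).val p) +
        Nat.gcd h.val (Nat.gcd (b₁ - b₂).val p) := by
      rcases hdeg with ⟨rfl, hsq | hb⟩
      · simp [hsq]
      · simp [hb]
    refine (Nat.cast_le.mpr hS).trans ?_
    norm_cast
    omega
  · have hS := ncard_kloosterman_system_le (a₁ := a₁) (c := b₂ - b₁) (h := h) (N := 4) ha₂
      fun t s ht hs => ncard_quarticLinePairs_le_four ha₁ <| by
        by_cases hh : h = 0
        · have hsq : a₁ ^ 2 ≠ a₂ ^ 2 := fun H => hdeg ⟨hh, Or.inl H⟩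
          exact Or.inr ⟨add_mul_ne_zero_of_sq_ne_sq ha₁ ht hsq,
            add_mul_ne_zero_of_sq_ne_sq ha₁ hs hsq,
            fun H => hdeg ⟨hh, Or.inr (sub_eq_zero.mp H).symm⟩⟩
        · exact Or.inl hh
    refine (Nat.cast_le.mpr hS).trans ?_
    norm_cast
    omega
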